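/- arXiv:math/9811130 — 3 statements merged into one kernel-verified Lean document; each statement's English description precedes it below -/
import Mathlib

section
/- Let g be a complex semisimple Lie algebra and let X ∈ g be a nilpotent element that is not a principal (regular) nilpotent element. Then dim Ker(ad X) ≥ rank(g) + 2. -/
open LieAlgebra Module

lemma aux_even_of_alt {K V : Type*} [Field K] [CharZero K] [AddCommGroup V] [Module K V]
    [FiniteDimensional K V] (B : V →ₗ[K] V →ₗ[K] K) (hB : B.IsAlt) :
    ∃ k, finrank K V = finrank K (LinearMap.ker B) + 2 * k := by
  obtain ⟨W, hW⟩ := Submodule.exists_isCompl (LinearMap.ker B)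
  have hsum := Submodule.finrank_add_eq_of_isCompl hW
  suffices Even (finrank K W) by
    obtain ⟨k, hk⟩ := this
    exact ⟨k, by omega⟩
  let b := finBasis K W
  let A : Matrix (Fin (finrank K W)) (Fin (finrank K W)) K :=
    Matrix.of fun i j => B (b i) (b j)
  have hAt : A.transpose = -A := by
    ext i j
    simp [A, hB.neg]
  have hdet : A.det ≠ 0 := by
    intro h0
    obtain ⟨v, hv, hv0⟩ := Matrix.exists_vecMul_eq_zero_iff.mpr h0
    let w : W := ∑ i, v i • b i
    have hw : w = 0 := by
      have h1 : ∀ j, B (w : V) (b j) = 0 := by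
        intro j
        have := congrFun hv0 j
        simpa [Matrix.vecMul, dotProduct, A, w] using this
      have h2 : ∀ x : W, B (w : V) x = 0 := by
        have : (B (w : V)).comp W.subtype = 0 := b.ext (by simpa using h1)
        intro x
        exact LinearMap.congr_fun this x
      have h3 : (w : V) ∈ LinearMap.ker B := by
        rw [LinearMap.mem_ker]
        ext x
        have hx : x ∈ LinearMap.ker B ⊔ W := by rw [hW.sup_eq_top]; trivial
        obtain ⟨y, hy, z, hz, rfl⟩ := Submodule.mem_sup.mp hx
        have hy' : B (w : V) y = 0 := by
          rw [← hB.neg, LinearMap.mem_ker.mp hy]; simp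
        simp [hy', h2 ⟨z, hz⟩]
      have h4 : (w : V) ∈ LinearMap.ker B ⊓ W := ⟨h3, w.2⟩
      rw [hW.inf_eq_bot] at h4
      exact Subtype.ext (by simpa using h4)
    apply hv
    funext i
    exact (Fintype.linearIndependent_iff.mp b.linearIndependent) v hw i
  by_contra hodd
  rw [Nat.not_even_iff_odd] at hodd
  have h := congrArg Matrix.det hAt
  rw [Matrix.det_transpose, Matrix.det_neg, Fintype.card_fin, hodd.neg_one_pow] at h
  apply hdet
  have h2 : (2 : K) * A.det = 0 := by linear_combination h
  simpa using h2

lemma aux_even_ad {L : Type*} [LieRing L] [LieAlgebra ℂ L] [Module.Finite ℂ L]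
    [LieAlgebra.IsKilling ℂ L] (X : L) :
    ∃ k, finrank ℂ L = finrank ℂ (LinearMap.ker (LieAlgebra.ad ℂ L X)) + 2 * k := by
  have hk : LinearMap.ker (LinearMap.comp (killingForm ℂ L) (LieAlgebra.ad ℂ L X))
      = LinearMap.ker (LieAlgebra.ad ℂ L X) := by
    apply LinearMap.ker_comp_of_ker_eq_bot
    exact LieAlgebra.IsKilling.ker_killingForm_eq_bot ℂ L
  rw [← hk]
  apply aux_even_of_alt
  intro Y
  have := LieModule.traceForm_apply_lie_apply ℂ L L X Y Y
  simpa [killingForm] using this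

lemma aux_regular {L : Type*} [LieRing L] [LieAlgebra ℂ L] [Module.Finite ℂ L]
    [LieAlgebra.IsKilling ℂ L] (x : L) (hx : LieAlgebra.IsRegular ℂ x) :
    finrank ℂ (LinearMap.ker (LieAlgebra.ad ℂ L x)) = LieAlgebra.rank ℂ L := by
  have hfr := (isRegular_iff_finrank_engel_eq_rank ℂ x).mp hx
  have hcard : (finrank ℂ L : Cardinal) ≤ Cardinal.mk ℂ :=
    Cardinal.natCast_le_aleph0.trans <| Cardinal.infinite_iff.mp inferInstance
  have hC : (LieSubalgebra.engel ℂ x).IsCartanSubalgebra := by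
    refine ⟨?_, LieSubalgebra.normalizer_engel _ _⟩
    apply LieSubalgebra.isNilpotent_of_forall_le_engel
    intro y hy
    set Ex : {LieSubalgebra.engel ℂ z | z ∈ LieSubalgebra.engel ℂ x} :=
      ⟨LieSubalgebra.engel ℂ x, x, LieSubalgebra.self_mem_engel _ _, rfl⟩
    suffices IsBot Ex from @this ⟨LieSubalgebra.engel ℂ y, y, hy, rfl⟩
    apply engel_isBot_of_isMin hcard (LieSubalgebra.engel ℂ x) Ex le_rfl
    rintro ⟨_, y, hy, rfl⟩ hyx
    suffices finrank ℂ (LieSubalgebra.engel ℂ x) ≤ finrank ℂ (LieSubalgebra.engel ℂ y) by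
      suffices LieSubalgebra.engel ℂ y = LieSubalgebra.engel ℂ x from this.ge
      apply LieSubalgebra.toSubmodule_injective
      exact Submodule.eq_of_le_of_finrank_le hyx this
    rw [hfr]
    apply rank_le_finrank_engel
  rw [← hfr]
  have : LinearMap.ker (LieAlgebra.ad ℂ L x) = (LieSubalgebra.engel ℂ x).toSubmodule := by
    apply le_antisymm
    · intro y hy
      have : y ∈ LieSubalgebra.engel ℂ x := by
        rw [LieSubalgebra.mem_engel_iff]
        exact ⟨1, by simpa using hy⟩
      exact this
    · intro y hy
      have h := LieModule.IsTrivial.trivial (L := LieSubalgebra.engel ℂ x)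
        (M := LieSubalgebra.engel ℂ x) ⟨x, LieSubalgebra.self_mem_engel _ _⟩ ⟨y, hy⟩
      simpa using congrArg Subtype.val h
  rw [this]
  rfl

section
attribute [local instance 100] LieRing.ofAssociativeRing

lemma aux_semicont {L : Type*} [LieRing L] [LieAlgebra ℂ L] [Module.Finite ℂ L]
    (X : L) : ∃ Y : L, LieAlgebra.IsRegular ℂ Y ∧
    finrank ℂ (LinearMap.ker (LieAlgebra.ad ℂ L Y)) ≤
      finrank ℂ (LinearMap.ker (LieAlgebra.ad ℂ L X)) := by
  classical
  obtain ⟨H, hH⟩ := LieAlgebra.exists_isRegular ℂ L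
  let b := finBasis ℂ L
  let P := (LinearMap.polyCharpoly (ad ℂ L).toLinearMap b).coeff (LieAlgebra.rank ℂ L)
  let q : Polynomial ℂ := MvPolynomial.aeval
    (fun i => Polynomial.C (b.repr X i) + Polynomial.X * Polynomial.C (b.repr (H - X) i)) P
  have hq : ∀ t : ℂ, q.eval t = MvPolynomial.eval (b.repr (X + t • (H - X))) P := by
    intro t
    have : Polynomial.aeval t q = MvPolynomial.aeval (b.repr (X + t • (H - X))) P := by
      simp only [q, ← AlgHom.comp_apply, MvPolynomial.comp_aeval]
      congr 2
      funext i
      simp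
    simpa [Polynomial.coe_aeval_eq_eval, MvPolynomial.aeval_eq_eval] using this
  have hreg : ∀ t : ℂ, q.eval t ≠ 0 → LieAlgebra.IsRegular ℂ (X + t • (H - X)) := by
    intro t ht
    rw [LieAlgebra.isRegular_iff_coeff_polyCharpoly_rank_ne_zero ℂ b]
    rwa [hq] at ht
  have hq0 : q ≠ 0 := by
    intro h0
    have := (LieAlgebra.isRegular_iff_coeff_polyCharpoly_rank_ne_zero ℂ b H).mp hH
    apply this
    have h1 := hq 1
    rw [h0] at h1
    rw [one_smul, add_sub_cancel, Polynomial.eval_zero] at h1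
    exact h1.symm
  obtain ⟨W, hW⟩ := Submodule.exists_isCompl (LinearMap.ker (LieAlgebra.ad ℂ L X))
  have hsum := Submodule.finrank_add_eq_of_isCompl hW
  let w := finBasis ℂ W
  let F : ℂ → Fin (finrank ℂ W) → (Fin (finrank ℂ L) → ℂ) := fun t i =>
    b.equivFun ⁅X, (w i : L)⁆ + t • b.equivFun ⁅H - X, (w i : L)⁆
  have hFc : Continuous F := by fun_prop
  have hF : ∀ t i, F t i = b.equivFun (ad ℂ L (X + t • (H - X)) (w i)) := by
    intro t i
    rw [ad_apply, add_lie, smul_lie, map_add, map_smul]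
  have hopen : IsOpen {t | LinearIndependent ℂ (F t)} :=
    isOpen_setOfPred_linearIndependent.preimage hFc
  have h0 : (0 : ℂ) ∈ {t | LinearIndependent ℂ (F t)} := by
    change LinearIndependent ℂ (F 0)
    have h1 : LinearIndependent ℂ (fun i => ad ℂ L X (w i)) := by
      have hk : LinearMap.ker ((ad ℂ L X).domRestrict W) = ⊥ := by
        rw [LinearMap.ker_eq_bot']
        intro m hm
        have : (m : L) ∈ LinearMap.ker (ad ℂ L X) ⊓ W := ⟨hm, m.2⟩
        rw [hW.inf_eq_bot] at this
        exact Subtype.ext (by simpa using this)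
      exact w.linearIndependent.map' _ hk
    have h2 := h1.map' b.equivFun.toLinearMap b.equivFun.ker
    have h3 : F 0 = b.equivFun.toLinearMap ∘ fun i => ad ℂ L X (w i) := by
      funext i
      rw [hF]; simp
    rw [h3]
    exact h2
  have hinf : Set.Infinite {t | LinearIndependent ℂ (F t)} :=
    infinite_of_mem_nhds 0 (hopen.mem_nhds h0)
  obtain ⟨t, ht, htq⟩ := hinf.exists_notMem_finset q.roots.toFinset
  have htq' : q.eval t ≠ 0 := by
    intro h
    apply htq
    simp [hq0, h]
  refine ⟨X + t • (H - X), hreg t htq', ?_⟩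
  have hli : LinearIndependent ℂ (fun i => ad ℂ L (X + t • (H - X)) (w i)) := by
    have ht' : LinearIndependent ℂ (F t) := ht
    apply LinearIndependent.of_comp b.equivFun.toLinearMap
    have h3 : F t = b.equivFun.toLinearMap ∘ fun i => ad ℂ L (X + t • (H - X)) (w i) := by
      funext i
      rw [hF]; rfl
    rw [h3] at ht'
    exact ht'
  have hle : finrank ℂ W ≤ finrank ℂ (LinearMap.range (ad ℂ L (X + t • (H - X)))) := by
    have h3 : finrank ℂ (Submodule.span ℂ
        (Set.range (fun i => ad ℂ L (X + t • (H - X)) (w i)))) = finrank ℂ W := by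
      rw [finrank_span_eq_card hli, Fintype.card_fin]
    rw [← h3]
    apply Submodule.finrank_mono
    rw [Submodule.span_le]
    rintro _ ⟨i, rfl⟩
    exact ⟨_, rfl⟩
  have hrn := LinearMap.finrank_range_add_finrank_ker (ad ℂ L (X + t • (H - X)))
  omega

end

/-- If `X` is a nilpotent element of a complex semisimple Lie algebra `g` that is not
principal (i.e. the dimension of the centralizer `Ker (ad X)` is not equal to the rank),
then `dim Ker (ad X) ≥ rank g + 2`. -/
theorem nonprincipal_nilpotent_centralizer_dim
    {L : Type*} [LieRing L] [LieAlgebra ℂ L] [Module.Finite ℂ L]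
    [LieAlgebra.IsSemisimple ℂ L]
    (X : L) (hX : IsNilpotent (LieAlgebra.ad ℂ L X))
    (hnp : finrank ℂ (LinearMap.ker (LieAlgebra.ad ℂ L X)) ≠ LieAlgebra.rank ℂ L) :
    LieAlgebra.rank ℂ L + 2 ≤ finrank ℂ (LinearMap.ker (LieAlgebra.ad ℂ L X)) := by
  obtain ⟨Y, hY, hle⟩ := aux_semicont X
  have hr := aux_regular Y hY
  obtain ⟨k, hk⟩ := aux_even_ad X
  obtain ⟨l, hl⟩ := aux_even_ad Y
  omega
end

section
/- Let g be a complex semisimple Lie algebra and X ∈ g a principal nilpotent element. Then the centralizer of X in g is an abelian Lie subalgebra consisting of nilpotent elements. -/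
open LieAlgebra Module

theorem pn_aux_QN {V : Type*} [AddCommGroup V] [Module ℂ V] [Module.Finite ℂ V]
    (A : End ℂ V) : ∃ Q N : End ℂ V, Q * N = 0 ∧ Q * A = A ∧
      Function.Injective (A + N) ∧
      finrank ℂ (LinearMap.range Q) = finrank ℂ (LinearMap.range A) := by
  obtain ⟨W, hW⟩ := Submodule.exists_isCompl (LinearMap.range A)
  obtain ⟨P, hP⟩ := LinearMap.exists_leftInverse_of_injective (LinearMap.ker A).subtype
    (Submodule.ker_subtype _)
  have h1 := Submodule.finrank_add_eq_of_isCompl hW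
  have h2 := LinearMap.finrank_range_add_finrank_ker A
  have hd : finrank ℂ (LinearMap.ker A) = finrank ℂ W := by omega
  let j : LinearMap.ker A ≃ₗ[ℂ] W := LinearEquiv.ofFinrankEq _ _ hd
  let Q : End ℂ V := (LinearMap.range A).projection W hW
  let N : End ℂ V := W.subtype ∘ₗ j.toLinearMap ∘ₗ P
  have hQN : Q * N = 0 := by
    ext x
    have : N x ∈ W := (j (P x)).2
    rw [Module.End.mul_apply, LinearMap.zero_apply]
    exact (Submodule.projection_apply_eq_zero_iff hW).mpr this
  have hQA : Q * A = A := by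
    ext x
    have : A x ∈ LinearMap.range A := ⟨x, rfl⟩
    rw [Module.End.mul_apply]
    exact Submodule.projection_apply_left hW ⟨A x, this⟩
  refine ⟨Q, N, hQN, hQA, ?_, ?_⟩
  · rw [injective_iff_map_eq_zero]
    intro x hx
    have hq : Q ((A + N) x) = A x := by
      have e1 := LinearMap.congr_fun hQN x
      have e2 := LinearMap.congr_fun hQA x
      simp only [Module.End.mul_apply, LinearMap.zero_apply] at e1 e2
      simp [e1, e2]
    have hA : A x = 0 := by rw [← hq, hx, map_zero]
    have hN : N x = 0 := by simpa [hA] using hx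
    have hPx : P x = 0 := by simpa [N] using hN
    have := LinearMap.congr_fun hP ⟨x, hA⟩
    simp [hPx] at this
    exact (Subtype.ext_iff.mp this).symm
  · exact congrArg (fun S : Submodule ℂ V => finrank ℂ S) (Submodule.range_projection hW)

open Filter Topology in
theorem pn_aux_limit {V : Type*} [AddCommGroup V] [Module ℂ V] [Module.Finite ℂ V]
    (A D : End ℂ V) (Φ : V →ₗ[ℂ] V →ₗ[ℂ] ℂ)
    (h : ∀ᶠ t in 𝓝[≠] (0 : ℂ), finrank ℂ (LinearMap.ker A) ≤
        finrank ℂ (LinearMap.ker (A + t • D)) ∧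
      ∀ y z, (A + t • D) y = 0 → (A + t • D) z = 0 → Φ y z = 0)
    (y z : V) (hy : A y = 0) (hz : A z = 0) : Φ y z = 0 := by
  obtain ⟨Q, N, hQN, hQA, hinj, hrk⟩ := pn_aux_QN A
  let b := Module.finBasis ℂ V
  let M : ℂ → Matrix (Fin (finrank ℂ V)) (Fin (finrank ℂ V)) ℂ :=
    fun t => LinearMap.toMatrix b b (A + N) + t • LinearMap.toMatrix b b D
  have hM : ∀ t, M t = LinearMap.toMatrix b b (A + N + t • D) := by
    intro t; simp [M]
  have hMc : Continuous M := by fun_prop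
  let c : ℂ → V → V := fun t v => Matrix.toLin b b (M t).adjugate v
  have hcc : ∀ v i, Continuous fun t => b.repr (c t v) i := by
    intro v i
    have : (fun t => b.repr (c t v) i) = fun t => ((M t).adjugate.mulVec (b.repr v)) i := by
      ext t
      simp [c, Matrix.repr_toLin]
    rw [this]
    have hadj : Continuous fun t => (M t).adjugate := hMc.matrix_adjugate
    have := hadj.matrix_mulVec (continuous_const (y := (⇑(b.repr v) : Fin (finrank ℂ V) → ℂ)))
    exact (continuous_apply i).comp this
  have hBc : ∀ t v, (A + N + t • D) (c t v) = (M t).det • v := by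
    intro t v
    have : (A + N + t • D) = Matrix.toLin b b (M t) := by
      rw [hM, Matrix.toLin_toMatrix]
    rw [this]
    simp only [c]
    rw [← LinearMap.comp_apply, ← Matrix.toLin_mul, Matrix.mul_adjugate]
    simp
  have hdet0 : (M 0).det ≠ 0 := by
    have : M 0 = LinearMap.toMatrix b b (A + N) := by simp [M]
    rw [this, LinearMap.det_toMatrix]
    intro h0
    have := LinearMap.bot_lt_ker_of_det_eq_zero h0
    rw [LinearMap.ker_eq_bot.mpr hinj] at this
    exact lt_irrefl _ this
  have hc0 : ∀ v, A v = 0 → c 0 (N v) = (M 0).det • v := by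
    intro v hv
    have e : N v = Matrix.toLin b b (M 0) v := by
      rw [hM, Matrix.toLin_toMatrix]; simp [hv]
    rw [e]
    simp only [c]
    rw [← LinearMap.comp_apply, ← Matrix.toLin_mul, Matrix.adjugate_mul]
    simp
  have hdet : ∀ᶠ t in 𝓝[≠] (0 : ℂ), (M t).det ≠ 0 :=
    (hMc.matrix_det.continuousAt.eventually_ne hdet0).filter_mono nhdsWithin_le_nhds
  let F : ℂ → ℂ := fun t => Φ (c t (N y)) (c t (N z))
  have hF : Continuous F := by
    have : F = fun t => ∑ i, ∑ j, b.repr (c t (N y)) i * (b.repr (c t (N z)) j * Φ (b i) (b j)) := by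
      ext t
      simp only [F]
      generalize c t (N y) = u
      generalize c t (N z) = w
      conv_lhs => rw [← b.sum_repr u, ← b.sum_repr w]
      simp only [map_sum, map_smul, LinearMap.sum_apply, LinearMap.smul_apply, smul_eq_mul,
        Finset.mul_sum]
      rw [Finset.sum_comm]
      refine Finset.sum_congr rfl fun i _ => Finset.sum_congr rfl fun j _ => ?_
      ring
    rw [this]
    refine continuous_finsetSum _ fun i _ => continuous_finsetSum _ fun j _ => ?_
    exact (hcc _ i).mul ((hcc _ j).mul continuous_const)
  have hF0 : ∀ᶠ t in 𝓝[≠] (0 : ℂ), F t = 0 := by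
    filter_upwards [h, hdet] with t ⟨ht1, ht2⟩ htd
    have hQB : Q * (A + N + t • D) = Q * (A + t • D) := by
      rw [mul_add, mul_add, mul_add, hQN, add_zero]
    have hsurj : Function.Surjective (A + N + t • D) := by
      intro v
      refine ⟨(M t).det⁻¹ • c t v, ?_⟩
      rw [map_smul, hBc, smul_smul, inv_mul_cancel₀ htd, one_smul]
    have hr : LinearMap.range (Q * (A + t • D)) = LinearMap.range Q := by
      rw [← hQB]
      exact LinearMap.range_comp_of_range_eq_top _ (LinearMap.range_eq_top.mpr hsurj)
    have hle : LinearMap.ker (A + t • D) ≤ LinearMap.ker (Q * (A + t • D)) :=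
      LinearMap.ker_le_ker_comp _ _
    have e1 := LinearMap.finrank_range_add_finrank_ker (Q * (A + t • D))
    have e2 := LinearMap.finrank_range_add_finrank_ker A
    rw [hr, hrk] at e1
    have heq := Submodule.eq_of_le_of_finrank_le hle (by omega)
    have key : ∀ v, (A + t • D) (c t (N v)) = 0 := by
      intro v
      have : c t (N v) ∈ LinearMap.ker (Q * (A + t • D)) := by
        rw [← hQB, LinearMap.mem_ker, Module.End.mul_apply, hBc, map_smul,
          ← Module.End.mul_apply, hQN]
        simp
      rw [← heq] at this
      exact this
    exact ht2 _ _ (key y) (key z)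
  have hlim : Tendsto F (𝓝[≠] 0) (𝓝 (F 0)) := hF.continuousAt.tendsto.mono_left nhdsWithin_le_nhds
  have hlim2 : Tendsto F (𝓝[≠] 0) (𝓝 0) :=
    tendsto_const_nhds.congr' (hF0.mono fun t ht => ht.symm)
  have h0 := tendsto_nhds_unique hlim hlim2
  simp only [F, hc0 y hy, hc0 z hz] at h0
  simpa [hdet0] using h0

theorem pn_aux_cartan {L : Type*} [LieRing L] [LieAlgebra ℂ L] [Module.Finite ℂ L]
    (x : L) (hx : IsRegular ℂ x) : (LieSubalgebra.engel ℂ x).IsCartanSubalgebra := by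
  have h : (finrank ℂ L : Cardinal) ≤ Cardinal.mk ℂ :=
    Cardinal.natCast_le_aleph0.trans <| Cardinal.infinite_iff.mp inferInstance
  refine ⟨?_, LieSubalgebra.normalizer_engel _ _⟩
  apply LieSubalgebra.isNilpotent_of_forall_le_engel
  intro y hy
  set Ex : {x_1 | ∃ z ∈ LieSubalgebra.engel ℂ x, LieSubalgebra.engel ℂ z = x_1} :=
    ⟨LieSubalgebra.engel ℂ x, x, LieSubalgebra.self_mem_engel _ _, rfl⟩
  suffices IsBot Ex from @this ⟨LieSubalgebra.engel ℂ y, y, hy, rfl⟩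
  apply engel_isBot_of_isMin h (LieSubalgebra.engel ℂ x) Ex le_rfl
  rintro ⟨_, y, hy, rfl⟩ hyx
  suffices finrank ℂ (LieSubalgebra.engel ℂ x) ≤ finrank ℂ (LieSubalgebra.engel ℂ y) by
    suffices LieSubalgebra.engel ℂ y = LieSubalgebra.engel ℂ x from this.ge
    apply LieSubalgebra.toSubmodule_injective
    exact Submodule.eq_of_le_of_finrank_le hyx this
  rw [(isRegular_iff_finrank_engel_eq_rank ℂ x).mp hx]
  apply rank_le_finrank_engel

theorem pn_aux_reg {L : Type*} [LieRing L] [LieAlgebra ℂ L] [Module.Finite ℂ L]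
    [LieAlgebra.IsSemisimple ℂ L] (x : L) (hx : IsRegular ℂ x) :
    rank ℂ L ≤ finrank ℂ (LinearMap.ker (ad ℂ L x)) ∧
    ∀ y z : L, ⁅x, y⁆ = 0 → ⁅x, z⁆ = 0 → ⁅y, z⁆ = 0 := by
  have hc := pn_aux_cartan x hx
  have hab : IsLieAbelian (LieSubalgebra.engel ℂ x) := inferInstance
  have hab' : ∀ y ∈ LieSubalgebra.engel ℂ x, ∀ z ∈ LieSubalgebra.engel ℂ x, ⁅y, z⁆ = 0 := by
    intro y hy z hz
    have := hab.trivial ⟨y, hy⟩ ⟨z, hz⟩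
    exact congrArg Subtype.val this
  have hm : ∀ y, ⁅x, y⁆ = 0 → y ∈ LieSubalgebra.engel ℂ x := by
    intro y hy
    rw [LieSubalgebra.mem_engel_iff]
    exact ⟨1, by simpa using hy⟩
  refine ⟨?_, fun y z hy hz => hab' y (hm y hy) z (hm z hz)⟩
  refine (rank_le_finrank_engel ℂ x).trans ?_
  have : (LieSubalgebra.engel ℂ x).toSubmodule ≤ LinearMap.ker (ad ℂ L x) := by
    intro y hy
    exact hab' x (LieSubalgebra.self_mem_engel _ _) y hy
  exact Submodule.finrank_mono this

section
attribute [local instance] LieRing.ofAssociativeRing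

open Filter Topology in
theorem pn_aux_generic {L : Type*} [LieRing L] [LieAlgebra ℂ L] [Module.Finite ℂ L]
    (X : L) : ∃ D : L, ∀ᶠ t in 𝓝[≠] (0 : ℂ), IsRegular ℂ (X + t • D) := by
  obtain ⟨H, hH⟩ := exists_isRegular ℂ L
  refine ⟨H - X, ?_⟩
  let b := Module.finBasis ℂ L
  let P := ((ad ℂ L).toLinearMap.polyCharpoly b).coeff (rank ℂ L)
  let q : Polynomial ℂ := MvPolynomial.aeval
    (fun i => Polynomial.C (b.repr X i) + Polynomial.X * Polynomial.C (b.repr (H - X) i)) P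
  have hq : ∀ t, q.eval t = MvPolynomial.eval (b.repr (X + t • (H - X))) P := by
    intro t
    simp only [q]
    clear_value P
    induction P using MvPolynomial.induction_on with
    | C a => simp
    | add p q hp hq => simp only [map_add, Polynomial.eval_add] at hp hq ⊢; rw [hp, hq]
    | mul_X p i hp =>
      rw [map_mul, map_mul, Polynomial.eval_mul, hp]
      congr 1
      simp
  have hq0 : q ≠ 0 := by
    intro h0
    have h1 := hq 1
    rw [h0] at h1
    have h2 := (isRegular_iff_coeff_polyCharpoly_rank_ne_zero ℂ b H).mp hH
    apply h2
    have e : X + (1 : ℂ) • (H - X) = H := by simp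
    rw [e, Polynomial.eval_zero] at h1
    exact h1.symm
  have hfin : {t | q.IsRoot t}.Finite := Polynomial.finite_setOfPred_isRoot hq0
  have : ∀ᶠ t in 𝓝[≠] (0 : ℂ), t ∉ {t | q.IsRoot t} :=
    nhdsNE_le_cofinite 0 (Set.Finite.compl_mem_cofinite hfin)
  filter_upwards [this] with t ht
  rw [isRegular_iff_coeff_polyCharpoly_rank_ne_zero ℂ b]
  rw [← hq t]
  exact ht

end

/-- Let `X` be a principal nilpotent element of a complex semisimple Lie algebra `g`,
i.e. a nilpotent element whose centralizer `Ker (ad X)` has dimension equal to the rank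
of `g`. Then the centralizer of `X` is an abelian Lie subalgebra consisting of nilpotent
elements. -/
theorem principal_nilpotent_centralizer_abelian_nilpotent
    {L : Type*} [LieRing L] [LieAlgebra ℂ L] [Module.Finite ℂ L]
    [LieAlgebra.IsSemisimple ℂ L]
    (X : L) (hX : IsNilpotent (LieAlgebra.ad ℂ L X))
    (hprin : finrank ℂ (LinearMap.ker (LieAlgebra.ad ℂ L X)) = LieAlgebra.rank ℂ L) :
    (∀ y z : L, ⁅X, y⁆ = 0 → ⁅X, z⁆ = 0 → ⁅y, z⁆ = 0) ∧
      (∀ y : L, ⁅X, y⁆ = 0 → IsNilpotent (LieAlgebra.ad ℂ L y)) := by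
  have hab : ∀ y z : L, ⁅X, y⁆ = 0 → ⁅X, z⁆ = 0 → ⁅y, z⁆ = 0 := by
    intro y z hy hz
    obtain ⟨D, hD⟩ := pn_aux_generic X
    let b := Module.finBasis ℂ L
    apply b.ext_elem
    intro i
    rw [map_zero, Finsupp.zero_apply]
    let Φ : L →ₗ[ℂ] L →ₗ[ℂ] ℂ := LinearMap.mk₂ ℂ (fun u w => b.coord i ⁅u, w⁆)
      (by intros; simp) (by intros; simp) (by intros; simp) (by intros; simp)
    have := pn_aux_limit (ad ℂ L X) (ad ℂ L D) Φ ?_ y z hy hz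
    · simpa [Φ] using this
    · filter_upwards [hD] with t ht
      obtain ⟨h1, h2⟩ := pn_aux_reg _ ht
      have e : ad ℂ L X + t • ad ℂ L D = ad ℂ L (X + t • D) := by simp
      rw [e, hprin]
      refine ⟨h1, fun y z hy hz => ?_⟩
      have := h2 y z hy hz
      simp [Φ, this]
  refine ⟨hab, fun y hy => ?_⟩
  by_contra hn
  have hμ : ∃ μ : ℂ, μ ≠ 0 ∧ (ad ℂ L y).HasEigenvalue μ := by
    by_contra hcon
    push Not at hcon
    apply hn
    have htop := Module.End.iSup_maxGenEigenspace_eq_top (ad ℂ L y)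
    have : ∀ μ : ℂ, μ ≠ 0 → (ad ℂ L y).maxGenEigenspace μ = ⊥ := by
      intro μ hμ
      by_contra hne
      have hu : (ad ℂ L y).HasUnifEigenvalue μ ⊤ := hne
      exact hcon μ hμ (hu.lt zero_lt_one)
    have h0 : (ad ℂ L y).maxGenEigenspace 0 = ⊤ := by
      rw [eq_top_iff, ← htop]
      refine iSup_le fun μ => ?_
      by_cases h : μ = 0
      · rw [h]
      · rw [this μ h]; exact bot_le
    rw [LinearMap.isNilpotent_iff_charpoly, LinearMap.charpoly_eq_X_pow_iff]
    intro m
    have hm : m ∈ (ad ℂ L y).maxGenEigenspace 0 := by rw [h0]; trivial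
    rw [Module.End.mem_maxGenEigenspace] at hm
    simpa using hm
  obtain ⟨μ, hμ0, hμ⟩ := hμ
  obtain ⟨v, hv⟩ := hμ.exists_hasEigenvector
  have hv1 : ⁅y, v⁆ = μ • v := hv.apply_eq_smul
  have hst : ∀ k : ℕ, ⁅y, ((ad ℂ L X) ^ k) v⁆ = μ • ((ad ℂ L X) ^ k) v := by
    intro k
    induction k with
    | zero => simpa using hv1
    | succ k ih =>
      rw [pow_succ', Module.End.mul_apply, ad_apply, leibniz_lie, ih, ← lie_skew y X, hy]
      simp
  have hex : ∃ k : ℕ, ((ad ℂ L X) ^ k) v = 0 := by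
    obtain ⟨k, hk⟩ := hX
    exact ⟨k, by rw [hk]; rfl⟩
  classical
  have hk := Nat.find_spec hex
  have hmin := fun m hm => Nat.find_min hex (m := m) hm
  generalize Nat.find hex = k at hk hmin
  cases k with
  | zero => exact hv.2 (by simpa using hk)
  | succ k =>
    rw [pow_succ', Module.End.mul_apply, ad_apply] at hk
    have h1 := hab _ _ hy hk
    rw [hst k] at h1
    exact hmin k (Nat.lt_succ_self k) ((smul_eq_zero.mp h1).resolve_left hμ0)
end

section
/- Let G be a connected complex reductive group with maximal torus H, Cartan subalgebra h, Weyl group W, and let X ∈ g be a regular nilpotent element. Then the differential at X of the adjoint quotient map g → h/W, restricted to any linear complement N of the tangent space Im(ad X) of the adjoint orbit through X, is a linear isomorphism onto the tangent space of h/W at the image of X. -/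
open Module MvPolynomial

/-- A polynomial `Q` (in the coordinates given by a basis `b` of a Lie algebra `L`) is
invariant under the adjoint action of the connected group if its directional derivative
at each point `x` along every adjoint direction `⁅y, x⁆` vanishes. -/
def IsAdInvariantPoly {L : Type*} [LieRing L] [LieAlgebra ℂ L] {m : ℕ}
    (b : Basis (Fin m) ℂ L) (Q : MvPolynomial (Fin m) ℂ) : Prop :=
  ∀ x y : L, ∑ j : Fin m,
    MvPolynomial.eval (⇑(b.repr x)) (MvPolynomial.pderiv j Q) * b.repr ⁅y, x⁆ j = 0


open TensorProduct in
theorem aux_deriv_ext {R S K : Type*} [CommRing R] [CommRing S] [CommRing K]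
    [Algebra R S] [Algebra R K] [Algebra S K] [IsScalarTower R S K]
    [Algebra.FormallyEtale S K] (D0 : Derivation R S K) :
    ∃ D : Derivation R K K, ∀ s : S, D (algebraMap S K s) = D0 s := by
  let l : Ω[S⁄R] →ₗ[S] K := D0.liftKaehlerDifferential
  let l' : K ⊗[S] Ω[S⁄R] →ₗ[K] K := l.liftBaseChange K
  let e := (KaehlerDifferential.tensorKaehlerEquivOfFormallyEtale R S K).symm
  refine ⟨(l' ∘ₗ e.toLinearMap).compDer (KaehlerDifferential.D R K), fun s => ?_⟩
  simp [e, KaehlerDifferential.tensorKaehlerEquivOfFormallyEtale_symm_D_algebraMap, l', l]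

open scoped IntermediateField.algebraAdjoinAdjoin in
theorem aux_deriv_exists {F K ι : Type*} [Field F] [CharZero F] [Field K] [Algebra F K]
    (p : ι → K) (hp : AlgebraicIndependent F p) [DecidableEq ι] (i : ι) :
    ∃ D : Derivation F K K, ∀ k, D (p k) = if k = i then 1 else 0 := by
  classical
  obtain ⟨t, hst, ht⟩ := exists_isTranscendenceBasis_superset (AlgebraicIndependent.coe_range hp)
  have h1 : Algebra.FormallyEtale (Algebra.adjoin F (Set.range ((↑) : t → K)))
      (IntermediateField.adjoin F (Set.range ((↑) : t → K))) :=
    .of_isLocalization (nonZeroDivisors _)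
  have := ht.isAlgebraic_field
  have h2 : Algebra.FormallyEtale (IntermediateField.adjoin F (Set.range ((↑) : t → K))) K :=
    Algebra.FormallyEtale.of_isSeparable _ _
  have h3 : Algebra.FormallyEtale (Algebra.adjoin F (Set.range ((↑) : t → K))) K :=
    .comp _ (IntermediateField.adjoin F (Set.range ((↑) : t → K))) _
  let : Algebra (MvPolynomial t F) K := (aeval ((↑) : t → K)).toAlgebra
  let : Algebra (MvPolynomial t F) (Algebra.adjoin F (Set.range ((↑) : t → K))) :=
    (ht.1.aevalEquiv : _ →+* _).toAlgebra
  have : IsScalarTower (MvPolynomial t F) (Algebra.adjoin F (Set.range ((↑) : t → K))) K :=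
    .of_algebraMap_eq fun _ => rfl
  have : IsScalarTower F (MvPolynomial t F) K :=
    .of_algebraMap_eq fun x => by
      show _ = aeval _ (C x)
      simp
  have h4 : Algebra.FormallyEtale (MvPolynomial t F) (Algebra.adjoin F (Set.range ((↑) : t → K))) :=
    .of_equiv (AlgEquiv.ofBijective (Algebra.ofId _ _) ht.1.aevalEquiv.bijective)
  have h5 : Algebra.FormallyEtale (MvPolynomial t F) K :=
    .comp _ (Algebra.adjoin F (Set.range ((↑) : t → K))) _
  have hinj : Function.Injective p := hp.injective
  let j : ι → t := fun k => ⟨p k, hst ⟨k, rfl⟩⟩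
  obtain ⟨D, hD⟩ := aux_deriv_ext (mkDerivation F (Pi.single (j i) (1 : K)))
  refine ⟨D, fun k => ?_⟩
  have := hD (X (j k))
  have e : algebraMap (MvPolynomial t F) K (X (j k)) = p k := by
    show aeval _ (X _) = _
    simp [j]
  rw [e, mkDerivation_X] at this
  rw [this, Pi.single_apply]
  simp [j, Subtype.ext_iff, hinj.eq_iff]

theorem aux_deriv_chain {F K : Type*} {σ : Type*} [Fintype σ] [CommRing F] [CommRing K] [Algebra F K]
    (φ : MvPolynomial σ F →ₐ[F] K) (D : Derivation F K K) (f : MvPolynomial σ F) :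
    D (φ f) = ∑ j, φ (pderiv j f) * D (φ (X j)) := by
  classical
  induction f using MvPolynomial.induction_on with
  | C a =>
    have : φ (C a) = algebraMap F K a := by rw [← MvPolynomial.algebraMap_eq]; simp
    simp [this]
  | add p q hp hq => simp [hp, hq, add_mul, Finset.sum_add_distrib]
  | mul_X p i hp =>
    simp only [map_mul, Derivation.leibniz, hp, smul_eq_mul, pderiv_X, map_add, add_mul,
      Finset.sum_add_distrib, Finset.mul_sum]
    congr 1
    · simp [Pi.single_apply, apply_ite]
    · exact Finset.sum_congr rfl fun _ _ => by ring

theorem aux_char_zero {L : Type*} [LieRing L] [LieAlgebra ℂ L] [Module.Finite ℂ L]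
    (hred : LieAlgebra.radical ℂ L = LieAlgebra.center ℂ L) (l : L →ₗ[ℂ] ℂ)
    (h1 : ∀ x y : L, l ⁅x, y⁆ = 0) (h2 : ∀ z : L, (∀ x : L, ⁅z, x⁆ = 0) → l z = 0) : l = 0 := by
  have hker : ∀ z : L, (∀ y, killingForm ℂ L z y = 0) → ∀ x : L, ⁅z, x⁆ = 0 := by
    intro z hz
    have : z ∈ LieIdeal.killingCompl ℂ L ⊤ := by
      rw [LieIdeal.mem_killingCompl]
      intro y _
      rw [LieModule.traceForm_comm]; exact hz y
    have := LieAlgebra.killingCompl_top_le_radical ℂ L this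
    rw [hred] at this
    intro x
    have h3 := (LieModule.mem_maxTrivSubmodule (R := ℂ) (L := L) (M := L) z).1 this x
    rw [← lie_skew, h3, neg_zero]
  obtain ⟨a, ha⟩ : l ∈ LinearMap.range (killingForm ℂ L) := by
    rw [← Subspace.dualCoannihilator_dualAnnihilator_eq (W := LinearMap.range (killingForm ℂ L))]
    rw [Submodule.mem_dualAnnihilator]
    intro w hw
    rw [Submodule.mem_dualCoannihilator] at hw
    apply h2
    apply hker
    intro y
    have := hw _ ⟨y, rfl⟩
    rw [LieModule.traceForm_comm]; exact this
  have hc : ∀ x : L, ∀ y : L, ⁅⁅a, x⁆, y⁆ = 0 := by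
    intro x
    apply hker
    intro y
    rw [LieModule.traceForm_apply_lie_apply]
    have := h1 x y
    rw [← ha] at this
    exact this
  ext y
  rw [← ha, LieModule.traceForm_comm, LieModule.traceForm_apply_apply]
  have : (LieModule.toEnd ℂ L L) y ∘ₗ (LieModule.toEnd ℂ L L) a = 0 := by
    ext x
    have := hc x y
    simp [← lie_skew y, this]
  rw [this]; simp

theorem aux_minor {K : Type*} [Field K] {r m : ℕ} (J : Matrix (Fin r) (Fin m) K)
    (h : LinearIndependent K J.row) : ∃ c : Fin r → Fin m, (J.submatrix id c).det ≠ 0 := by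
  have hr : J.rank = r := by simpa using h.rank_matrix
  rw [Matrix.rank_eq_finrank_span_cols] at hr
  have htop : Submodule.span K (Set.range J.col) = ⊤ := by
    apply Submodule.eq_top_of_finrank_eq
    simp [hr]
  obtain ⟨t, ht, hspan, hli⟩ := exists_linearIndependent K (Set.range J.col)
  let B : Basis t K (Fin r → K) := Basis.mk hli (by simp [hspan, htop])
  have : Finite t := (Set.finite_range J.col).subset ht
  have := Fintype.ofFinite t
  have hcard : Fintype.card t = r := by
    rw [← Module.finrank_eq_card_basis B]; simp
  let e : Fin r ≃ t := (Fintype.equivFinOfCardEq hcard).symm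
  have hc : ∀ i : Fin r, ∃ k : Fin m, J.col k = e i := fun i => ht (e i).2
  choose c hc using hc
  refine ⟨c, ?_⟩
  have h2 : LinearIndependent K (J.submatrix id c).col := by
    have : (J.submatrix id c).col = (fun x : t => (x : Fin r → K)) ∘ e := by
      funext i
      rw [Function.comp, ← hc i]
      rfl
    rw [this]
    exact hli.comp e e.injective
  rw [Matrix.linearIndependent_cols_iff_isUnit, Matrix.isUnit_iff_isUnit_det] at h2
  exact h2.ne_zero

theorem aux_leibniz_prod {R S ι : Type*} [CommRing R] [CommRing S] [Algebra R S] [DecidableEq ι]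
    (D : Derivation R S S) (s : Finset ι) (f : ι → S) :
    D (∏ i ∈ s, f i) = ∑ i ∈ s, ∏ j ∈ s, (if j = i then D (f j) else f j) := by
  induction s using Finset.induction_on with
  | empty => simp
  | insert a s ha ih =>
    rw [Finset.prod_insert ha, Derivation.leibniz, ih, Finset.sum_insert ha,
      Finset.prod_insert ha, add_comm]
    congr 1
    · rw [if_pos rfl, smul_eq_mul, mul_comm]
      congr 1
      exact Finset.prod_congr rfl fun j hj => by rw [if_neg (by rintro rfl; exact ha hj)]
    · rw [smul_eq_mul, Finset.mul_sum]
      refine Finset.sum_congr rfl fun i hi => ?_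
      rw [Finset.prod_insert ha, if_neg (by rintro rfl; exact ha hi)]

theorem aux_deriv_det {R S n : Type*} [CommRing R] [CommRing S] [Algebra R S] [DecidableEq n]
    [Fintype n] (D : Derivation R S S) (A : Matrix n n S) :
    D A.det = ∑ b, (A.updateCol b (fun a => D (A a b))).det := by
  simp only [Matrix.det_apply, map_sum]
  rw [Finset.sum_comm]
  refine Finset.sum_congr rfl fun σ _ => ?_
  rw [← Finset.smul_sum, Units.smul_def, Units.smul_def, map_zsmul, aux_leibniz_prod]
  congr 1
  refine Finset.sum_congr rfl fun b _ => Finset.prod_congr rfl fun j _ => ?_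
  rw [Matrix.updateCol_apply]
  split_ifs with h <;> simp [h]

theorem aux_minor_stable {R S : Type*} [CommRing R] [CommRing S] [Algebra R S] {r m : ℕ}
    (D : Derivation R S S) (J : Matrix (Fin r) (Fin m) S) (A : Fin m → Fin m → S)
    (hJ : ∀ a k, D (J a k) = ∑ j, A k j * J a j) (z : S)
    (hz : ∀ c : Fin r → Fin m, z ∣ (J.submatrix id c).det) (c : Fin r → Fin m) :
    z ∣ D (J.submatrix id c).det := by
  rw [aux_deriv_det]
  refine Finset.dvd_sum fun b _ => ?_
  have : (fun a => D (J.submatrix id c a b)) = ∑ j, A (c b) j • J.col j := by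
    funext a
    simp [hJ]
  rw [← Matrix.cramer_apply, this, map_sum, Finset.sum_apply]
  refine Finset.dvd_sum fun j _ => ?_
  rw [map_smul, Pi.smul_apply, smul_eq_mul]
  refine Dvd.dvd.mul_left ?_ _
  rw [Matrix.cramer_apply]
  convert hz (Function.update c b j) using 2
  ext a k
  rw [Matrix.updateCol_apply]
  by_cases h : k = b <;> simp [h]

theorem aux_semiinv {R S : Type*} [Field R] [CharZero R] [CommRing S] [IsDomain S] [Algebra R S]
    [WfDvdMonoid S] {ι : Type*}
    (D : Derivation R S S) (p : ι → S) (hp : ∃ c, p c ≠ 0)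
    (hst : ∀ z, (∀ c, z ∣ p c) → ∀ c, z ∣ D (p c)) (q : S) (hq : Prime q) (hqp : ∀ c, q ∣ p c) :
    q ∣ D q := by
  classical
  obtain ⟨c0, hc0⟩ := hp
  have hfin : FiniteMultiplicity q (p c0) := FiniteMultiplicity.of_not_isUnit hq.not_isUnit hc0
  obtain ⟨n, hn⟩ := hfin
  have hex : ∃ k, ¬ ∀ c, q ^ (k + 1) ∣ p c := ⟨n, fun h => hn (h c0)⟩
  obtain ⟨k, hk, hmin⟩ : ∃ k, (¬ ∀ c, q ^ (k + 1) ∣ p c) ∧ ∀ c, q ^ k ∣ p c := by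
    refine ⟨Nat.find hex, Nat.find_spec hex, ?_⟩
    rcases h : Nat.find hex with _ | k
    · simp
    · have := Nat.find_min hex (m := k) (by omega)
      push Not at this
      exact this
  push Not at hk
  obtain ⟨c, hc⟩ := hk
  obtain ⟨k, rfl⟩ : ∃ j, k = j + 1 := by
    rcases k with _ | k
    · exact absurd (by simpa using hqp c) hc
    · exact ⟨k, rfl⟩
  obtain ⟨u, hu⟩ := hmin c
  have h1 := hst _ hmin c
  rw [hu, Derivation.leibniz, Derivation.leibniz_pow] at h1
  simp only [smul_eq_mul, nsmul_eq_mul] at h1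
  rw [dvd_add_right (Dvd.intro _ rfl)] at h1
  have h2 : q ^ k * q ∣ q ^ k * (((k + 1 : ℕ) : S) * u * D q) := by
    convert h1 using 1
    · rw [pow_succ]
    · rw [show k + 1 - 1 = k from rfl]
      ring
  rw [mul_dvd_mul_iff_left (pow_ne_zero _ hq.ne_zero)] at h2
  have hun : IsUnit (((k + 1 : ℕ) : S)) := by
    rw [← map_natCast (algebraMap R S)]
    exact (IsUnit.mk0 _ (Nat.cast_ne_zero.2 (Nat.succ_ne_zero k))).map _
  rw [mul_assoc, hun.dvd_mul_left] at h2
  rcases hq.dvd_or_dvd h2 with h3 | h3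
  · refine absurd ?_ hc
    rw [hu, pow_succ]
    exact mul_dvd_mul_left _ h3
  · exact h3

theorem aux_totalDegree_pderiv {σ F : Type*} [CommRing F] (i : σ) (f : MvPolynomial σ F)
    (h : pderiv i f ≠ 0) : (pderiv i f).totalDegree + 1 ≤ f.totalDegree := by
  classical
  obtain ⟨s, hs, hd⟩ : ∃ s ∈ (pderiv i f).support, (pderiv i f).totalDegree = s.degree := by
    obtain ⟨s, hs, hd⟩ := Finset.exists_mem_eq_sup _ (support_nonempty.2 h)
      (fun s : σ →₀ ℕ => s.degree)
    refine ⟨s, hs, ?_⟩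
    rw [← hd]
    rfl
  have h1 : s + Finsupp.single i 1 ∈ f.support := by
    rw [MvPolynomial.mem_support_iff, coeff_pderiv] at hs
    rw [MvPolynomial.mem_support_iff]
    intro h0
    simp [h0] at hs
  have := le_totalDegree h1
  rw [hd]
  change (s + Finsupp.single i 1).degree ≤ _ at this
  simpa using this

theorem aux_const_of_pderiv {σ F : Type*} [Field F] [CharZero F] (f : MvPolynomial σ F)
    (h : ∀ i, pderiv i f = 0) : ∃ a, f = C a := by
  classical
  refine ⟨coeff 0 f, ?_⟩
  ext s
  rw [coeff_C]
  split_ifs with h0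
  · rw [h0]
  · obtain ⟨i, hi⟩ : ∃ i, s i ≠ 0 := by
      by_contra hh
      push Not at hh
      exact h0 (by ext i; simp [hh])
    have h1 := congrArg (coeff (s - Finsupp.single i 1)) (h i)
    rw [coeff_pderiv, tsub_add_cancel_of_le (by simpa using Nat.one_le_iff_ne_zero.2 hi)] at h1
    rw [coeff_zero, mul_eq_zero] at h1
    rcases h1 with h1 | h1
    · exact h1
    · exact absurd h1 (Nat.cast_add_one_ne_zero _)

theorem aux_not_dvd_pderiv {σ F : Type*} [Field F] (i : σ) (f : MvPolynomial σ F)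
    (h : pderiv i f ≠ 0) : ¬ f ∣ pderiv i f := by
  rintro ⟨g, hg⟩
  have hf : f ≠ 0 := by rintro rfl; simp at h
  have hg0 : g ≠ 0 := by rintro rfl; simp [hg] at h
  have h1 := aux_totalDegree_pderiv i f h
  rw [hg, totalDegree_mul_of_isDomain hf hg0] at h1
  omega

theorem aux_eq_smul {σ F : Type*} [Fintype σ] [Field F] (q : MvPolynomial σ F)
    (D : Derivation F (MvPolynomial σ F) (MvPolynomial σ F))
    (hD : ∀ j, (D (X j)).totalDegree ≤ 1)
    (hDq : D q = ∑ j, pderiv j q * D (X j)) (hdvd : q ∣ D q) : ∃ a : F, D q = C a * q := by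
  by_cases h0 : D q = 0
  · exact ⟨0, by simp [h0]⟩
  have hdeg : (D q).totalDegree ≤ q.totalDegree := by
    rw [hDq]
    refine totalDegree_finsetSum_le fun j _ => ?_
    by_cases hj : pderiv j q = 0
    · simp [hj]
    · have h1 := aux_totalDegree_pderiv j q hj
      have h2 := totalDegree_mul (pderiv j q) (D (X j))
      have h3 := hD j
      omega
  obtain ⟨g, hg⟩ := hdvd
  have hq : q ≠ 0 := by rintro rfl; simp at h0
  have hg0 : g ≠ 0 := by rintro rfl; simp [hg] at h0
  rw [hg, totalDegree_mul_of_isDomain hq hg0] at hdeg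
  have := totalDegree_eq_zero_iff_eq_C.1 (show g.totalDegree = 0 by omega)
  exact ⟨coeff 0 g, by rw [hg, mul_comm, ← this]⟩

theorem aux_degreeOf {σ F : Type*} [CommRing F] (i : σ) (f : MvPolynomial σ F) :
    degreeOf i f = 0 ↔ i ∉ f.vars := by
  classical
  rw [degreeOf_def, vars_def, Multiset.mem_toFinset, Multiset.count_eq_zero]

theorem aux_gen_indep {r m : ℕ} (P : Fin r → MvPolynomial (Fin m) ℂ)
    (hP : AlgebraicIndependent ℂ P) :
    ∃ c : Fin r → Fin m,
      ((Matrix.of fun a k => pderiv k (P a) : Matrix (Fin r) (Fin m) _).submatrix id c).det ≠ 0 := by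
  classical
  let K := FractionRing (MvPolynomial (Fin m) ℂ)
  let φ : MvPolynomial (Fin m) ℂ →ₐ[ℂ] K := IsScalarTower.toAlgHom ℂ _ _
  have hφ : Function.Injective φ := IsFractionRing.injective (MvPolynomial (Fin m) ℂ) K
  have hind : AlgebraicIndependent ℂ (φ ∘ P) := hP.map' hφ
  let J : Matrix (Fin r) (Fin m) (MvPolynomial (Fin m) ℂ) := Matrix.of fun a k => pderiv k (P a)
  obtain ⟨c, hc⟩ := aux_minor (J.map φ) (by
    rw [Fintype.linearIndependent_iff]
    intro g hg i
    obtain ⟨D, hD⟩ := aux_deriv_exists _ hind i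
    have h1 : ∀ k, ∑ a, g a * φ (pderiv k (P a)) = 0 := fun k => by
      have := congrFun hg k
      simpa [J] using this
    have h2 : ∑ a, g a * D (φ (P a)) = 0 := by
      rw [Finset.sum_congr rfl fun a _ => by rw [aux_deriv_chain φ D (P a), Finset.mul_sum]]
      rw [Finset.sum_comm]
      simp_rw [← mul_assoc, ← Finset.sum_mul, h1]
      simp
    have h3 : ∀ a, D (φ (P a)) = if a = i then 1 else 0 := hD
    simpa [h3] using h2)
  refine ⟨c, fun h => hc ?_⟩
  have : (J.map φ).submatrix id c = (φ : _ →+* K).mapMatrix (J.submatrix id c) := rfl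
  rw [this, ← RingHom.map_det, h, map_zero]

theorem aux_codim_one {r m : ℕ} (P : Fin r → MvPolynomial (Fin m) ℂ)
    (q : MvPolynomial (Fin m) ℂ) (hq : Prime q) (F : MvPolynomial (Fin r) ℂ) (hF : aeval P F = q)
    (hker : ∀ G, q ∣ aeval P G → F ∣ G) :
    ∃ c : Fin r → Fin m, ¬ q ∣
      ((Matrix.of fun a k => pderiv k (P a) : Matrix (Fin r) (Fin m) _).submatrix id c).det := by
  classical
  have : (Ideal.span {q}).IsPrime := (Ideal.span_singleton_prime hq.ne_zero).2 hq
  let K := FractionRing (MvPolynomial (Fin m) ℂ ⧸ Ideal.span {q})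
  let φ : MvPolynomial (Fin m) ℂ →ₐ[ℂ] K :=
    (IsScalarTower.toAlgHom ℂ (MvPolynomial (Fin m) ℂ ⧸ Ideal.span {q}) K).comp
      (Ideal.Quotient.mkₐ ℂ (Ideal.span {q}))
  have hφ : ∀ f, φ f = 0 ↔ q ∣ f := by
    intro f
    have h1 : φ f = algebraMap (MvPolynomial (Fin m) ℂ ⧸ Ideal.span {q}) K
      (Ideal.Quotient.mk _ f) := rfl
    rw [h1, FaithfulSMul.algebraMap_eq_zero_iff, Ideal.Quotient.eq_zero_iff_dvd]
  have hqC : ∀ a, q ≠ C a := by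
    rintro a rfl
    by_cases ha : a = 0
    · exact hq.ne_zero (by simp [ha])
    · exact hq.not_isUnit ((IsUnit.mk0 a ha).map C)
  obtain ⟨k0, hk0⟩ : ∃ k, pderiv k q ≠ 0 := by
    by_contra h
    push Not at h
    obtain ⟨a, ha⟩ := aux_const_of_pderiv q h
    exact hqC a ha
  obtain ⟨i0, hi0⟩ : ∃ i, pderiv i F ≠ 0 := by
    by_contra h
    push Not at h
    obtain ⟨a, ha⟩ := aux_const_of_pderiv F h
    exact hqC a (by rw [← hF, ha]; simp [MvPolynomial.algebraMap_eq])
  have hF0 : F ≠ 0 := by rintro rfl; simp at hi0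
  have hFi0 : φ (aeval P (pderiv i0 F)) ≠ 0 := by
    rw [Ne, hφ]
    exact fun h => aux_not_dvd_pderiv i0 F hi0 (hker _ h)
  have hdeg : F.degreeOf i0 ≠ 0 := by
    intro h
    apply hi0
    apply pderiv_eq_zero_of_notMem_vars
    rw [← aux_degreeOf]
    exact h
  have hind : AlgebraicIndependent ℂ (fun k : {k // k ≠ i0} => φ (P k)) := by
    rw [algebraicIndependent_iff]
    intro G hG
    have h1 : φ (aeval P (rename Subtype.val G)) = 0 := by
      rw [← hG, aeval_rename, ← MvPolynomial.comp_aeval_apply]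
      rfl
    rw [hφ] at h1
    obtain ⟨H, hH⟩ := hker _ h1
    by_contra hG0
    have hr0 : rename (Subtype.val : {k // k ≠ i0} → Fin r) G ≠ 0 := by
      rw [Ne, map_eq_zero_iff _ (rename_injective _ Subtype.val_injective)]
      exact hG0
    have hH0 : H ≠ 0 := by rintro rfl; simp [hr0] at hH
    have h2 := congrArg (degreeOf i0) hH
    rw [degreeOf_mul_eq hF0 hH0] at h2
    have h3 : degreeOf i0 (rename (Subtype.val : {k // k ≠ i0} → Fin r) G) = 0 := by
      rw [aux_degreeOf]
      intro h
      have := vars_rename _ _ h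
      simp at this
    omega
  have hchain : ∀ k, pderiv k q = ∑ a, aeval P (pderiv a F) * pderiv k (P a) := by
    intro k
    have := aux_deriv_chain (K := MvPolynomial (Fin m) ℂ) (aeval P) (pderiv k) F
    simp only [hF, aeval_X] at this
    exact this
  let J : Matrix (Fin r) (Fin m) (MvPolynomial (Fin m) ℂ) := Matrix.of fun a k => pderiv k (P a)
  obtain ⟨c, hc⟩ := aux_minor (J.map φ) (by
    rw [Fintype.linearIndependent_iff]
    intro g hg
    have h1 : ∀ k, ∑ a, g a * φ (pderiv k (P a)) = 0 := fun k => by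
      have := congrFun hg k
      simpa [J] using this
    set t : K := g i0 / φ (aeval P (pderiv i0 F)) with ht
    have hgt : ∀ i, g i = t * φ (aeval P (pderiv i F)) := by
      intro i
      by_cases hi : i = i0
      · subst hi
        rw [ht, div_mul_cancel₀ _ hFi0]
      obtain ⟨D, hD⟩ := aux_deriv_exists _ hind ⟨i, hi⟩
      have hD' : ∀ a, D (φ (P a)) = (if a = i then 1 else 0) +
          (if a = i0 then D (φ (P i0)) else 0) := by
        intro a
        by_cases ha : a = i0
        · subst ha
          simp [Ne.symm hi]
        · simpa [ha] using hD ⟨a, ha⟩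
      have h2 : ∑ a, g a * D (φ (P a)) = 0 := by
        rw [Finset.sum_congr rfl fun a _ => by rw [aux_deriv_chain φ D (P a), Finset.mul_sum]]
        rw [Finset.sum_comm]
        simp_rw [← mul_assoc, ← Finset.sum_mul, h1]
        simp
      have h3 := aux_deriv_chain (φ.comp (aeval P)) D F
      have h4 : φ q = 0 := (hφ q).2 dvd_rfl
      simp only [AlgHom.comp_apply, hF, h4, map_zero, aeval_X] at h3
      have h2' : g i + g i0 * D (φ (P i0)) = 0 := by
        rw [← h2, Finset.sum_congr rfl fun a _ => by rw [hD' a, mul_add]]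
        simp [Finset.sum_add_distrib]
      have h3' : φ (aeval P (pderiv i F)) + φ (aeval P (pderiv i0 F)) * D (φ (P i0)) = 0 := by
        rw [h3, Finset.sum_congr rfl fun a _ => by rw [hD' a, mul_add]]
        simp [Finset.sum_add_distrib]
      rw [ht, div_mul_eq_mul_div, eq_div_iff hFi0]
      linear_combination φ (aeval P (pderiv i0 F)) * h2' - g i0 * h3'
    have h5 : t * φ (pderiv k0 q) = 0 := by
      rw [← h1 k0, hchain, map_sum, Finset.mul_sum]
      refine Finset.sum_congr rfl fun a _ => ?_
      rw [hgt a, map_mul, mul_assoc]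
    have h6 : φ (pderiv k0 q) ≠ 0 := by
      rw [Ne, hφ]
      exact aux_not_dvd_pderiv k0 q hk0
    have h7 : t = 0 := (mul_eq_zero.1 h5).resolve_right h6
    intro i
    rw [hgt, h7, zero_mul])
  refine ⟨c, fun h => hc ?_⟩
  have : (J.map φ).submatrix id c = (φ : _ →+* K).mapMatrix (J.submatrix id c) := rfl
  rw [this, ← RingHom.map_det]
  exact (hφ _).2 h
/-- The derivation of the polynomial ring given by the adjoint vector field of `y`. -/
noncomputable def auxD {L : Type*} [LieRing L] [LieAlgebra ℂ L] {m : ℕ}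
    (b : Basis (Fin m) ℂ L) (y : L) :
    Derivation ℂ (MvPolynomial (Fin m) ℂ) (MvPolynomial (Fin m) ℂ) :=
  mkDerivation ℂ fun j => ∑ k, C (b.repr ⁅y, b k⁆ j) * X k

theorem auxD_X {L : Type*} [LieRing L] [LieAlgebra ℂ L] {m : ℕ}
    (b : Basis (Fin m) ℂ L) (y : L) (j : Fin m) :
    auxD b y (X j) = ∑ k, C (b.repr ⁅y, b k⁆ j) * X k := mkDerivation_X _ _ _

theorem auxD_chain {m : ℕ}
    (D : Derivation ℂ (MvPolynomial (Fin m) ℂ) (MvPolynomial (Fin m) ℂ))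
    (f : MvPolynomial (Fin m) ℂ) : D f = ∑ j, pderiv j f * D (X j) :=
  aux_deriv_chain (AlgHom.id ℂ _) D f

theorem aux_poly_ext {L : Type*} [LieRing L] [LieAlgebra ℂ L] {m : ℕ}
    (b : Basis (Fin m) ℂ L) (f g : MvPolynomial (Fin m) ℂ)
    (h : ∀ x : L, eval (⇑(b.repr x)) f = eval (⇑(b.repr x)) g) : f = g := by
  apply MvPolynomial.funext
  intro v
  have := h (b.equivFun.symm v)
  have e : ⇑(b.repr (b.equivFun.symm v)) = v := b.equivFun.apply_symm_apply v
  rwa [e] at this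

theorem aux_repr_lie {L : Type*} [LieRing L] [LieAlgebra ℂ L] {m : ℕ}
    (b : Basis (Fin m) ℂ L) (y x : L) (j : Fin m) :
    ∑ k, b.repr ⁅y, b k⁆ j * b.repr x k = b.repr ⁅y, x⁆ j := by
  conv_rhs => rw [← b.sum_repr x]
  simp only [lie_sum, lie_smul, map_sum, map_smul, Finsupp.coe_finsetSum, Finset.sum_apply,
    Finsupp.coe_smul, Pi.smul_apply, smul_eq_mul]
  exact Finset.sum_congr rfl fun _ _ => mul_comm _ _

theorem auxD_eval {L : Type*} [LieRing L] [LieAlgebra ℂ L] {m : ℕ}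
    (b : Basis (Fin m) ℂ L) (y x : L) (f : MvPolynomial (Fin m) ℂ) :
    eval (⇑(b.repr x)) (auxD b y f) =
      ∑ j, eval (⇑(b.repr x)) (pderiv j f) * b.repr ⁅y, x⁆ j := by
  rw [auxD_chain]
  simp only [auxD_X, map_sum, map_mul, eval_C, eval_X, aux_repr_lie]

theorem auxD_inv {L : Type*} [LieRing L] [LieAlgebra ℂ L] {m : ℕ}
    (b : Basis (Fin m) ℂ L) (f : MvPolynomial (Fin m) ℂ) :
    IsAdInvariantPoly b f ↔ ∀ y, auxD b y f = 0 := by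
  constructor
  · intro h y
    apply aux_poly_ext b
    intro x
    rw [auxD_eval, h x y, map_zero]
  · intro h x y
    rw [← auxD_eval, h y, map_zero]

theorem auxD_pderiv_X {L : Type*} [LieRing L] [LieAlgebra ℂ L] {m : ℕ}
    (b : Basis (Fin m) ℂ L) (y : L) (j k : Fin m) :
    pderiv k (auxD b y (X j)) = C (b.repr ⁅y, b k⁆ j) := by
  rw [auxD_X]
  simp [pderiv_X, Pi.single_apply]

theorem auxD_pderiv {L : Type*} [LieRing L] [LieAlgebra ℂ L] {m : ℕ}
    (b : Basis (Fin m) ℂ L) (y : L) (k : Fin m) (f : MvPolynomial (Fin m) ℂ) :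
    auxD b y (pderiv k f) = pderiv k (auxD b y f) - ∑ j, C (b.repr ⁅y, b k⁆ j) * pderiv j f := by
  have h := auxD_chain ⁅auxD b y, pderiv k⁆ f
  simp only [Derivation.commutator_apply] at h
  rw [sub_eq_iff_eq_add] at h
  rw [h, add_comm, sub_eq_add_neg, ← Finset.sum_neg_distrib]
  congr 1
  refine Finset.sum_congr rfl fun j _ => ?_
  have : auxD b y (pderiv k (X j)) = 0 := by
    classical
    rw [pderiv_X, Pi.single_apply]
    split_ifs <;> simp
  rw [this, auxD_pderiv_X]
  ring

theorem auxD_lie {L : Type*} [LieRing L] [LieAlgebra ℂ L] {m : ℕ}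
    (b : Basis (Fin m) ℂ L) (y z : L) (f : MvPolynomial (Fin m) ℂ) :
    auxD b ⁅y, z⁆ f = auxD b z (auxD b y f) - auxD b y (auxD b z f) := by
  have h1 : auxD b ⁅y, z⁆ = ⁅auxD b z, auxD b y⁆ := by
    apply MvPolynomial.derivation_ext
    intro j
    apply aux_poly_ext b
    intro x
    rw [Derivation.commutator_apply, map_sub]
    have h2 : ∀ u v : L, eval (⇑(b.repr x)) (auxD b u (auxD b v (X j))) =
        b.repr ⁅v, ⁅u, x⁆⁆ j := by
      intro u v
      rw [auxD_eval]
      simp only [auxD_pderiv_X, eval_C, aux_repr_lie]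
    rw [h2, h2, auxD_X]
    simp only [map_sum, map_mul, eval_C, eval_X, aux_repr_lie]
    rw [lie_lie, map_sub, Finsupp.sub_apply]
  rw [h1, Derivation.commutator_apply]

theorem auxD_add {L : Type*} [LieRing L] [LieAlgebra ℂ L] {m : ℕ}
    (b : Basis (Fin m) ℂ L) (y z : L) (f : MvPolynomial (Fin m) ℂ) :
    auxD b (y + z) f = auxD b y f + auxD b z f := by
  apply aux_poly_ext b
  intro x
  simp [auxD_eval, mul_add, Finset.sum_add_distrib]

theorem auxD_smul {L : Type*} [LieRing L] [LieAlgebra ℂ L] {m : ℕ}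
    (b : Basis (Fin m) ℂ L) (a : ℂ) (z : L) (f : MvPolynomial (Fin m) ℂ) :
    auxD b (a • z) f = C a * auxD b z f := by
  apply aux_poly_ext b
  intro x
  simp only [auxD_eval, smul_lie, map_smul, Finsupp.smul_apply, smul_eq_mul, map_mul, eval_C,
    Finset.mul_sum]
  exact Finset.sum_congr rfl fun _ _ => by ring

theorem aux_semi_inv_inv {L : Type*} [LieRing L] [LieAlgebra ℂ L] [Module.Finite ℂ L]
    (hred : LieAlgebra.radical ℂ L = LieAlgebra.center ℂ L)
    {m : ℕ} (b : Basis (Fin m) ℂ L) (q : MvPolynomial (Fin m) ℂ) (hq : q ≠ 0)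
    (h : ∀ y, ∃ a : ℂ, auxD b y q = C a * q) (y : L) : auxD b y q = 0 := by
  choose l hl using h
  have hinj : ∀ a c : ℂ, C a * q = C c * q → a = c := fun a c hac =>
    C_injective _ _ (mul_right_cancel₀ hq hac)
  let l' : L →ₗ[ℂ] ℂ :=
    { toFun := l
      map_add' := fun y z => hinj _ _ (by rw [← hl, auxD_add, hl, hl, C_add, add_mul])
      map_smul' := fun a z => hinj _ _ (by
        rw [← hl, auxD_smul, hl, RingHom.id_apply, smul_eq_mul, C_mul, mul_assoc]) }
  have h0 : l' = 0 := by
    apply aux_char_zero hred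
    · intro x y
      apply hinj
      change C (l ⁅x, y⁆) * q = _
      rw [← hl, auxD_lie, hl, hl]
      simp only [Derivation.leibniz, derivation_C, smul_zero, add_zero, smul_eq_mul, hl, map_zero,
        zero_mul]
      ring
    · intro z hz
      apply hinj
      change C (l z) * q = _
      rw [← hl]
      apply aux_poly_ext b
      intro x
      simp [auxD_eval, hz]
  rw [hl, show l y = 0 from LinearMap.congr_fun h0 y]
  simp

theorem aux_coprime {L : Type*} [LieRing L] [LieAlgebra ℂ L] [Module.Finite ℂ L]
    (hred : LieAlgebra.radical ℂ L = LieAlgebra.center ℂ L)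
    {m r : ℕ} (b : Basis (Fin m) ℂ L)
    (P : Fin r → MvPolynomial (Fin m) ℂ)
    (hPinv : ∀ i, IsAdInvariantPoly b (P i))
    (hPind : AlgebraicIndependent ℂ P)
    (hPgen : ∀ Q : MvPolynomial (Fin m) ℂ,
      IsAdInvariantPoly b Q → Q ∈ Algebra.adjoin ℂ (Set.range P))
    (q : MvPolynomial (Fin m) ℂ) (hq : Prime q) :
    ∃ c : Fin r → Fin m, ¬ q ∣
      ((Matrix.of fun a k => pderiv k (P a) : Matrix (Fin r) (Fin m) _).submatrix id c).det := by
  by_contra hcon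
  push Not at hcon
  have hsemi : ∀ y, q ∣ auxD b y q := by
    intro y
    refine aux_semiinv (auxD b y) _ (aux_gen_indep P hPind) ?_ q hq hcon
    intro z hz
    refine aux_minor_stable (auxD b y) _ (fun k j => - C (b.repr ⁅y, b k⁆ j)) ?_ z hz
    intro a k
    simp only [Matrix.of_apply]
    rw [auxD_pderiv, (auxD_inv b _).1 (hPinv a) y, map_zero, zero_sub, ← Finset.sum_neg_distrib]
    exact Finset.sum_congr rfl fun _ _ => by ring
  have hqinv : ∀ y, auxD b y q = 0 := by
    apply aux_semi_inv_inv hred b q hq.ne_zero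
    intro y
    refine aux_eq_smul q (auxD b y) ?_ (auxD_chain _ _) (hsemi y)
    intro j
    rw [auxD_X]
    refine totalDegree_finsetSum_le fun k _ => ?_
    refine (totalDegree_mul _ _).trans ?_
    simp
  have hgen : ∀ f, (∀ y, auxD b y f = 0) → ∃ G : MvPolynomial (Fin r) ℂ, aeval P G = f := by
    intro f hf
    have := hPgen f ((auxD_inv b f).2 hf)
    rwa [Algebra.adjoin_range_eq_range_aeval] at this
  obtain ⟨F, hF⟩ := hgen q hqinv
  obtain ⟨c, hc⟩ := aux_codim_one P q hq F hF (by
    rintro G ⟨u, hu⟩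
    have hGinv : ∀ y, auxD b y (aeval P G) = 0 := by
      intro y
      rw [aux_deriv_chain (K := MvPolynomial (Fin m) ℂ) (aeval P) (auxD b y) G]
      refine Finset.sum_eq_zero fun j _ => ?_
      rw [aeval_X, (auxD_inv b _).1 (hPinv j) y, mul_zero]
    obtain ⟨H, hH⟩ := hgen u (by
      intro y
      have := hGinv y
      rw [hu, Derivation.leibniz, hqinv, smul_zero, add_zero, smul_eq_mul] at this
      exact (mul_eq_zero.1 this).resolve_left hq.ne_zero)
    refine ⟨H, hPind ?_⟩
    rw [map_mul, hF, hH, hu])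
  exact hc (hcon c)

theorem aux_prime_factor {m : ℕ} (v : Fin m → ℂ) (f : MvPolynomial (Fin m) ℂ) (hf : f ≠ 0)
    (h : eval v f = 0) : ∃ q, Prime q ∧ q ∣ f ∧ eval v q = 0 := by
  revert hf h
  refine UniqueFactorizationMonoid.induction_on_prime f ?_ ?_ ?_
  · intro h; exact absurd rfl h
  · intro x hx _ h
    exact absurd h (hx.map (eval v)).ne_zero
  · intro a p ha hp ih hne h
    rw [map_mul, mul_eq_zero] at h
    rcases h with h | h
    · exact ⟨p, hp, dvd_mul_right _ _, h⟩
    · obtain ⟨q, h1, h2, h3⟩ := ih ha h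
      exact ⟨q, h1, h2.mul_left _, h3⟩

theorem aux_repr_sub {L : Type*} [AddCommGroup L] [Module ℂ L] {m r : ℕ} (b : Basis (Fin m) ℂ L)
    {N : Submodule ℂ L} (nb : Basis (Fin r) ℂ N) (v : N) (j : Fin m) :
    b.repr (v : L) j = ∑ i, nb.repr v i * b.repr (nb i : L) j := by
  have h : (v : L) = ∑ i, nb.repr v i • (nb i : L) := by
    have := congrArg N.subtype (nb.sum_repr v)
    rw [map_sum] at this
    simpa using this.symm
  conv_lhs => rw [h]
  simp only [map_sum, map_smul, Finsupp.coe_finsetSum, Finset.sum_apply, Finsupp.coe_smul,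
    Pi.smul_apply, smul_eq_mul]

theorem aux_det_ne_zero {L : Type*} [LieRing L] [LieAlgebra ℂ L] [Module.Finite ℂ L]
    (hred : LieAlgebra.radical ℂ L = LieAlgebra.center ℂ L)
    {m r : ℕ} (b : Basis (Fin m) ℂ L)
    (P : Fin r → MvPolynomial (Fin m) ℂ)
    (hPinv : ∀ i, IsAdInvariantPoly b (P i))
    (hPind : AlgebraicIndependent ℂ P)
    (hPgen : ∀ Q : MvPolynomial (Fin m) ℂ,
      IsAdInvariantPoly b Q → Q ∈ Algebra.adjoin ℂ (Set.range P))
    (Z : L) (N : Submodule ℂ L) (nb : Basis (Fin r) ℂ N)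
    (hN : IsCompl (LinearMap.range (LieAlgebra.ad ℂ L Z)) N) :
    (Matrix.of fun (a i : Fin r) => ∑ j : Fin m,
        eval (⇑(b.repr Z)) (pderiv j (P a)) * b.repr (nb i : L) j).det ≠ 0 := by
  have hdec : ∀ k, ∃ (u : L) (w : N), ⁅Z, u⁆ + (w : L) = b k := by
    intro k
    have : b k ∈ LinearMap.range (LieAlgebra.ad ℂ L Z) ⊔ N := by
      rw [hN.sup_eq_top]; trivial
    obtain ⟨y, ⟨u, rfl⟩, w, hw, h⟩ := Submodule.mem_sup.1 this
    exact ⟨u, ⟨w, hw⟩, h⟩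
  choose u w huw using hdec
  let J : Matrix (Fin r) (Fin m) (MvPolynomial (Fin m) ℂ) := Matrix.of fun a k => pderiv k (P a)
  let JN : Matrix (Fin r) (Fin r) (MvPolynomial (Fin m) ℂ) :=
    Matrix.of fun a i => ∑ j, pderiv j (P a) * C (b.repr (nb i : L) j)
  let W : Matrix (Fin m) (Fin m) (MvPolynomial (Fin m) ℂ) :=
    Matrix.of fun j k => - auxD b (u k) (X j) + C (b.repr (w k : L) j)
  let T : Matrix (Fin r) (Fin m) (MvPolynomial (Fin m) ℂ) :=
    Matrix.of fun i k => C (nb.repr (w k) i)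
  let ev := eval (⇑(b.repr Z))
  have hW : ev W.det = 1 := by
    rw [RingHom.map_det]
    have : ev.mapMatrix W = 1 := by
      ext j k
      have h1 : ev (auxD b (u k) (X j)) = b.repr ⁅u k, Z⁆ j := by
        simp only [ev, auxD_X, map_sum, map_mul, eval_C, eval_X, aux_repr_lie]
      have h2 : ev.mapMatrix W j k = - ev (auxD b (u k) (X j)) + b.repr (w k : L) j := by
        simp [W, ev]
      rw [h2, h1]
      have h3 : b.repr (b k) j = (1 : Matrix (Fin m) (Fin m) ℂ) j k := by
        rw [b.repr_self, Matrix.one_apply, Finsupp.single_apply]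
        simp only [eq_comm]
      have h4 : b.repr ⁅u k, Z⁆ j = - b.repr ⁅Z, u k⁆ j := by
        rw [← lie_skew (u k) Z, map_neg, Finsupp.neg_apply]
      rw [← h3, ← huw k, h4, neg_neg, map_add, Finsupp.add_apply]
    rw [this, Matrix.det_one]
  have hJW : J * W = JN * T := by
    ext1 a k
    have h1 := auxD_chain (auxD b (u k)) (P a)
    rw [(auxD_inv b _).1 (hPinv a)] at h1
    have h2 : ∀ j, b.repr (w k : L) j = ∑ i, nb.repr (w k) i * b.repr (nb i : L) j := aux_repr_sub b nb (w k)
    simp only [Matrix.mul_apply, J, W, JN, T, Matrix.of_apply, mul_add, mul_neg,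
      Finset.sum_add_distrib, Finset.sum_neg_distrib, ← h1, neg_zero, zero_add, h2, map_sum,
      Finset.mul_sum, Finset.sum_mul, map_mul]
    rw [Finset.sum_comm]
    exact Finset.sum_congr rfl fun _ _ => Finset.sum_congr rfl fun _ _ => by ring
  have hdJ : W.det • J = JN * (T * W.adjugate) := by
    rw [← Matrix.mul_assoc, ← hJW, Matrix.mul_assoc, Matrix.mul_adjugate]
    simp
  have hminor : ∀ c : Fin r → Fin m, W.det ^ r * (J.submatrix id c).det =
      JN.det * ((T * W.adjugate).submatrix id c).det := by
    intro c
    have h1 : W.det • J.submatrix id c = JN * (T * W.adjugate).submatrix id c := by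
      ext1 a k
      exact congrFun (congrFun hdJ a) (c k)
    rw [← Matrix.det_mul, ← h1, Matrix.det_smul, Fintype.card_fin]
  have hmain : ev JN.det ≠ 0 := by
    intro h0
    have hne : JN.det ≠ 0 := by
      intro h
      obtain ⟨c, hc⟩ := aux_gen_indep P hPind
      have h1 := hminor c
      rw [h, zero_mul, mul_eq_zero] at h1
      rcases h1 with h1 | h1
      · have h2 := eq_zero_of_pow_eq_zero h1
        simp [h2] at hW
      · exact hc h1
    obtain ⟨q, hq, hqd, hq0⟩ := aux_prime_factor _ _ hne h0
    obtain ⟨c, hc⟩ := aux_coprime hred b P hPinv hPind hPgen q hq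
    have h1 : q ∣ W.det ^ r * (J.submatrix id c).det := by
      rw [hminor c]
      exact hqd.mul_right _
    obtain ⟨g, hg⟩ := hq.dvd_of_dvd_pow ((hq.dvd_or_dvd h1).resolve_right hc)
    rw [hg, map_mul, show ev q = 0 from hq0, zero_mul] at hW
    exact zero_ne_one hW
  rw [RingHom.map_det] at hmain
  convert hmain using 2
  ext a i
  simp [JN, ev]

/-- **Steinberg/Kostant.**  Let `g` be the Lie algebra of a connected complex reductive
group, and let the adjoint quotient map `g → h/W ≅ ℂ^r` (`r = rank g`) be given by
algebraically independent invariant polynomials `P i` generating the full algebra of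
invariant polynomials.  If `X` is a regular nilpotent element, then the differential at
`X` of the adjoint quotient map, restricted to any linear complement `N` of the tangent
space `Im (ad X)` of the adjoint orbit through `X`, is a linear isomorphism onto the
tangent space `ℂ^r` of `h/W` at the image of `X`. -/
theorem adjoint_quotient_differential_bijective_on_complement
    {L : Type*} [LieRing L] [LieAlgebra ℂ L] [Module.Finite ℂ L]
    (hred : LieAlgebra.radical ℂ L = LieAlgebra.center ℂ L)
    {m : ℕ} (b : Basis (Fin m) ℂ L)
    (P : Fin (LieAlgebra.rank ℂ L) → MvPolynomial (Fin m) ℂ)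
    (hPinv : ∀ i, IsAdInvariantPoly b (P i))
    (hPind : AlgebraicIndependent ℂ P)
    (hPgen : ∀ Q : MvPolynomial (Fin m) ℂ,
      IsAdInvariantPoly b Q → Q ∈ Algebra.adjoin ℂ (Set.range P))
    (X : L) (hXnil : IsNilpotent (LieAlgebra.ad ℂ L X))
    (hXreg : finrank ℂ (LinearMap.ker (LieAlgebra.ad ℂ L X)) = LieAlgebra.rank ℂ L)
    (N : Submodule ℂ L)
    (hN : IsCompl (LinearMap.range (LieAlgebra.ad ℂ L X)) N) :
    Function.Bijective fun v : N => fun i : Fin (LieAlgebra.rank ℂ L) =>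
      ∑ j : Fin m,
        MvPolynomial.eval (⇑(b.repr X)) (MvPolynomial.pderiv j (P i)) * b.repr (v : L) j := by
  have hfin : finrank ℂ N = LieAlgebra.rank ℂ L := by
    have h1 := LinearMap.finrank_range_add_finrank_ker (LieAlgebra.ad ℂ L X : L →ₗ[ℂ] L)
    have h2 := Submodule.finrank_add_eq_of_isCompl hN
    have h3 : finrank ℂ (LinearMap.ker (LieAlgebra.ad ℂ L X : L →ₗ[ℂ] L)) =
      LieAlgebra.rank ℂ L := hXreg
    omega
  let nb : Basis (Fin (LieAlgebra.rank ℂ L)) ℂ N := finBasisOfFinrankEq ℂ N hfin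
  have hdet := aux_det_ne_zero hred b P hPinv hPind hPgen X N nb hN
  set A := (Matrix.of fun (a i : Fin (LieAlgebra.rank ℂ L)) => ∑ j : Fin m,
        eval (⇑(b.repr X)) (pderiv j (P a)) * b.repr (nb i : L) j) with hA
  have hu : IsUnit A := (Matrix.isUnit_iff_isUnit_det A).2 (isUnit_iff_ne_zero.2 hdet)
  have hbij : Function.Bijective A.mulVec :=
    ⟨Matrix.mulVec_injective_iff_isUnit.2 hu, Matrix.mulVec_surjective_iff_isUnit.2 hu⟩
  convert hbij.comp nb.equivFun.bijective using 1
  funext v i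
  have h2 : ∀ j, b.repr (v : L) j = ∑ i, nb.repr v i * b.repr (nb i : L) j := aux_repr_sub b nb v
  simp only [h2, Function.comp, Matrix.mulVec, dotProduct, hA, Matrix.of_apply, Finset.mul_sum,
    Finset.sum_mul, Basis.equivFun_apply]
  rw [Finset.sum_comm]
  exact Finset.sum_congr rfl fun _ _ => Finset.sum_congr rfl fun _ _ => by ring
end
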